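/- Let g be a real symmetric invertible 4×4 matrix of Lorentzian signature, and let σ ∈ ℝ⁴ satisfy σᵀ g^{-1} σ < 0. Set V := √(−σᵀ g^{-1} σ) and σ̂ := σ / V. Then the symmetric 4×4 matrix e := g + 2 σ̂ σ̂ᵀ is positive definite. -/

import Mathlib

open Matrix

/-- The Minkowski matrix diag(-1,1,1,1). -/
def minkowskiMat : Matrix (Fin 4) (Fin 4) ℝ :=
  Matrix.diagonal (fun i => if i = 0 then -1 else 1)

/-- A real symmetric 4×4 matrix has Lorentzian signature if it is congruent to
diag(-1,1,1,1). -/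
def IsLorentzian (g : Matrix (Fin 4) (Fin 4) ℝ) : Prop :=
  ∃ P : Matrix (Fin 4) (Fin 4) ℝ, IsUnit P.det ∧ Pᵀ * g * P = minkowskiMat

/-- For a timelike covector `s`, the quadratic form `-η(s, s) η(y, y) + 2 (s y)²` is positive
definite, where `η` is the Minkowski form. -/
lemma minkowski_add_sq_pos (s y : Fin 4 → ℝ) (hs : s ⬝ᵥ minkowskiMat *ᵥ s < 0) (hy : y ≠ 0) :
    0 < (y ⬝ᵥ minkowskiMat *ᵥ y) * (-(s ⬝ᵥ minkowskiMat *ᵥ s)) + 2 * (s ⬝ᵥ y) ^ 2 := by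
  simp only [minkowskiMat, mulVec_diagonal, dotProduct, Fin.sum_univ_four, Fin.isValue,
    if_true, one_ne_zero, Fin.reduceEq, if_false] at hs ⊢
  generalize s 0 = a, s 1 = b, s 2 = c, s 3 = d at *
  have hD : 0 < a ^ 2 - (b ^ 2 + c ^ 2 + d ^ 2) := by linarith
  have hy' : 0 < y 0 ^ 2 ∨ 0 < y 1 ^ 2 + y 2 ^ 2 + y 3 ^ 2 := by
    by_contra! h
    apply hy
    ext i
    fin_cases i <;> simp <;> nlinarith [sq_nonneg (y 0), sq_nonneg (y 1), sq_nonneg (y 2),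
      sq_nonneg (y 3)]
  generalize y 0 = t, y 1 = u, y 2 = v, y 3 = w at *
  have hS : 0 < a ^ 2 + (b ^ 2 + c ^ 2 + d ^ 2) := by
    nlinarith [sq_nonneg b, sq_nonneg c, sq_nonneg d]
  refine pos_of_mul_pos_right (a := a ^ 2 + (b ^ 2 + c ^ 2 + d ^ 2)) ?_ hS.le
  have key : 0 < ((a ^ 2 + (b ^ 2 + c ^ 2 + d ^ 2)) * t + 2 * a * (b * u + c * v + d * w)) ^ 2 +
      (a ^ 2 - (b ^ 2 + c ^ 2 + d ^ 2)) *
        ((a ^ 2 - (b ^ 2 + c ^ 2 + d ^ 2)) * (u ^ 2 + v ^ 2 + w ^ 2) +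
          2 * ((b * v - c * u) ^ 2 + (b * w - d * u) ^ 2 + (c * w - d * v) ^ 2)) := by
    by_cases h : 0 < u ^ 2 + v ^ 2 + w ^ 2
    · positivity
    · have ht : t ≠ 0 := by
        rintro rfl
        simp [h] at hy'
      have hu : u = 0 := by nlinarith [sq_nonneg u, sq_nonneg v, sq_nonneg w]
      have hv : v = 0 := by nlinarith [sq_nonneg u, sq_nonneg v, sq_nonneg w]
      have hw : w = 0 := by nlinarith [sq_nonneg u, sq_nonneg v, sq_nonneg w]
      subst hu hv hw
      simp only [mul_zero, add_zero, sub_zero, ne_eq, OfNat.ofNat_ne_zero, not_false_eq_true,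
        zero_pow]
      positivity
  refine key.trans_eq ?_
  ring

/-- If `Pᵀ g P` is the Minkowski matrix, then `g⁻¹ = P η Pᵀ`. -/
lemma inv_eq_mul_minkowskiMat_mul {g P : Matrix (Fin 4) (Fin 4) ℝ} (hP : IsUnit P.det)
    (h : Pᵀ * g * P = minkowskiMat) : g⁻¹ = P * minkowskiMat * Pᵀ := by
  have hη : minkowskiMat * minkowskiMat = 1 := by
    rw [minkowskiMat, diagonal_mul_diagonal, ← diagonal_one]
    congr 1
    ext i
    split_ifs <;> norm_num
  have hPt : IsUnit Pᵀ.det := by rwa [det_transpose]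
  apply inv_eq_right_inv
  calc g * (P * minkowskiMat * Pᵀ)
      = Pᵀ⁻¹ * (Pᵀ * g * P) * minkowskiMat * Pᵀ := by
        simp only [Matrix.mul_assoc, nonsing_inv_mul_cancel_left _ _ hPt]
    _ = 1 := by rw [h, Matrix.mul_assoc Pᵀ⁻¹, hη, Matrix.mul_one, nonsing_inv_mul _ hPt]

/-- For a Lorentzian metric `g` and a timelike covector `σ`, the matrix
`e = g + 2 σ̂ σ̂ᵀ` (with `σ̂` the normalisation of `σ`) is positive definite. -/
theorem riemannian_metric_posDef (g : Matrix (Fin 4) (Fin 4) ℝ) (hsym : g.IsSymm)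
    (hinv : IsUnit g.det) (hlor : IsLorentzian g)
    (σ : Fin 4 → ℝ) (hσ : σ ⬝ᵥ g⁻¹.mulVec σ < 0)
    (V : ℝ) (hV : V = Real.sqrt (-(σ ⬝ᵥ g⁻¹.mulVec σ)))
    (σh : Fin 4 → ℝ) (hσh : σh = V⁻¹ • σ)
    (e : Matrix (Fin 4) (Fin 4) ℝ) (he : e = g + (2:ℝ) • Matrix.vecMulVec σh σh) :
    e.PosDef := by
  obtain ⟨P, hP, hPg⟩ := hlor
  have hV2 : V ^ 2 = -(σ ⬝ᵥ g⁻¹ *ᵥ σ) := by rw [hV, Real.sq_sqrt (by linarith)]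
  have hs : σ ⬝ᵥ g⁻¹ *ᵥ σ = (Pᵀ *ᵥ σ) ⬝ᵥ minkowskiMat *ᵥ (Pᵀ *ᵥ σ) := by
    rw [inv_eq_mul_minkowskiMat_mul hP hPg, ← mulVec_mulVec, ← mulVec_mulVec, dotProduct_mulVec,
      mulVec_transpose]
  have hV2pos : 0 < V ^ 2 := by linarith
  have hV0 : V ≠ 0 := by
    rintro rfl
    simp at hV2pos
  refine PosDef.of_dotProduct_mulVec_pos ?_ fun x hx => ?_
  · rw [he, IsHermitian, conjTranspose_eq_transpose_of_trivial, transpose_add, hsym,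
      transpose_smul, transpose_vecMulVec]
  · obtain ⟨y, rfl⟩ : ∃ y, P *ᵥ y = x :=
      ⟨P⁻¹ *ᵥ x, by rw [mulVec_mulVec, mul_nonsing_inv _ hP, one_mulVec]⟩
    have hy : y ≠ 0 := by
      rintro rfl
      simp at hx
    have hpos := minkowski_add_sq_pos (Pᵀ *ᵥ σ) y (hs ▸ hσ) hy
    have hgy : (P *ᵥ y) ⬝ᵥ g *ᵥ (P *ᵥ y) = y ⬝ᵥ minkowskiMat *ᵥ y := by
      rw [← hPg, ← mulVec_mulVec, ← mulVec_mulVec, dotProduct_mulVec y, vecMul_transpose]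
    rw [← hs, ← hV2, ← hgy, mulVec_transpose, ← dotProduct_mulVec] at hpos
    have heq : star (P *ᵥ y) ⬝ᵥ e *ᵥ (P *ᵥ y) =
        (((P *ᵥ y) ⬝ᵥ g *ᵥ (P *ᵥ y)) * V ^ 2 + 2 * (σ ⬝ᵥ P *ᵥ y) ^ 2) / V ^ 2 := by
      rw [he, hσh, star_trivial, add_mulVec, dotProduct_add, smul_mulVec, vecMulVec_mulVec]
      simp only [smul_dotProduct, dotProduct_smul, smul_eq_mul, MulOpposite.smul_eq_mul_unop,
        MulOpposite.unop_op, dotProduct_comm (P *ᵥ y) σ]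
      field_simp
    rw [heq]
    positivity
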